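/- Let p ≥ 2, α = p−1 and θ ≥ 0. For every σ with 0 ≤ σ ≤ μ_{α,θ} the critical Trudinger–Moser supremum TMC(σ,α,θ) is finite. -/

import Mathlib

open MeasureTheory Real Filter ENNReal

/-- The fractional-dimension spherical volume constant `ω_θ = 2π^((θ+1)/2)/Γ((θ+1)/2)`. -/
noncomputable def omegaW (θ : ℝ) : ℝ := 2 * Real.pi ^ ((θ + 1) / 2) / Real.Gamma ((θ + 1) / 2)

/-- Weighted integral `∫₀^∞ f dλ_θ = ω_θ ∫₀^∞ f(r) r^θ dr` (for nonnegative integrands,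
valued in `ℝ≥0∞`). -/
noncomputable def wInt (θ : ℝ) (f : ℝ → ℝ) : ℝ≥0∞ :=
  ENNReal.ofReal (omegaW θ) *
    ∫⁻ r in Set.Ioi (0 : ℝ), ENNReal.ofReal (f r) * ENNReal.ofReal (r ^ θ)

/-- The weighted Lebesgue norm `‖u‖_{L^q_θ}` (valued in `ℝ≥0∞`). -/
noncomputable def wNorm (θ q : ℝ) (u : ℝ → ℝ) : ℝ≥0∞ :=
  (wInt θ fun r => |u r| ^ q) ^ (1 / q)

/-- Membership in the weighted Sobolev space `X = X^{1,p}_∞(α,θ)`: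
`u` is locally absolutely continuous on `(0,∞)` with a.e. derivative `u'`
(expressed through the fundamental theorem of calculus on compact subintervals),
`u(r) → 0` as `r → ∞`, `‖u‖_{L^p_θ} < ∞` and `‖u'‖_{L^p_α} < ∞`. -/
structure MemX (p α θ : ℝ) (u u' : ℝ → ℝ) : Prop where
  ftc_int : ∀ a b : ℝ, 0 < a → a ≤ b → IntervalIntegrable u' MeasureTheory.volume a b
  ftc : ∀ a b : ℝ, 0 < a → a ≤ b → u b - u a = ∫ t in a..b, u' t
  lim_zero : Filter.Tendsto u Filter.atTop (nhds 0)
  fin_u : wNorm θ p u < ⊤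
  fin_u' : wNorm α p u' < ⊤

/-- Full norm on `X`: `‖u‖ = (‖u‖_{L^p_θ}^p + ‖u'‖_{L^p_α}^p)^{1/p}`. -/
noncomputable def Xnorm (p α θ : ℝ) (u u' : ℝ → ℝ) : ℝ≥0∞ :=
  ((wNorm θ p u) ^ p + (wNorm α p u') ^ p) ^ (1 / p)

/-- The truncated exponential `φ_p(t) = Σ_{j ∈ ℕ, j ≥ p-1} t^j / j!`. -/
noncomputable def phiP (p t : ℝ) : ℝ :=
  ∑' j : ℕ, if p - 1 ≤ (j : ℝ) then t ^ j / (Nat.factorial j : ℝ) else 0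

/-- The critical constant `μ_{α,θ} = (θ+1) ω_α^{1/α}`. -/
noncomputable def muC (α θ : ℝ) : ℝ := (θ + 1) * (omegaW α) ^ (1 / α)

/-- The Trudinger–Moser functional `∫₀^∞ φ_p(μ |u|^{p/(p-1)}) dλ_θ`. -/
noncomputable def TMfunc (p θ μ : ℝ) (u : ℝ → ℝ) : ℝ≥0∞ :=
  wInt θ fun r => phiP p (μ * |u r| ^ (p / (p - 1)))

/-- The subcritical Trudinger–Moser supremum
`TMSC(μ,α,θ) = sup { ‖u‖_{L^p_θ}^{-p} ∫₀^∞ φ_p(μ|u|^{p/(p-1)}) dλ_θ : u ∈ X, u ≠ 0, ‖u'‖_{L^p_α} ≤ 1 }`. -/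
noncomputable def TMSC (p α θ μ : ℝ) : ℝ≥0∞ :=
  ⨆ (u : ℝ → ℝ) (u' : ℝ → ℝ) (_ : MemX p α θ u u') (_ : u ≠ 0)
    (_ : wNorm α p u' ≤ 1), (wNorm θ p u) ^ (-p) * TMfunc p θ μ u

/-- The critical Trudinger–Moser supremum
`TMC(σ,α,θ) = sup { ∫₀^∞ φ_p(σ|u|^{p/(p-1)}) dλ_θ : u ∈ X, ‖u‖ ≤ 1 }`. -/
noncomputable def TMC (p α θ σ : ℝ) : ℝ≥0∞ :=
  ⨆ (u : ℝ → ℝ) (u' : ℝ → ℝ) (_ : MemX p α θ u u') (_ : Xnorm p α θ u u' ≤ 1),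
    TMfunc p θ σ u

/-- `k₀ = min { j ∈ ℕ : j ≥ p - 1 }`. -/
noncomputable def k0 (p : ℝ) : ℕ := sInf {j : ℕ | p - 1 ≤ (j : ℝ)}

/-- `TMC(σ,α,θ)` is attained by some `u ∈ X` with `‖u‖ ≤ 1`. -/
def TMCAttained (p α θ σ : ℝ) : Prop :=
  ∃ u u' : ℝ → ℝ, MemX p α θ u u' ∧ Xnorm p α θ u u' ≤ 1 ∧
    TMC p α θ σ = TMfunc p θ σ u

/-- `σ_* = inf { σ ∈ (0, μ_{α,θ}) : TMC(σ,α,θ) is attained }`. -/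
noncomputable def sigmaStar (p α θ : ℝ) : ℝ :=
  sInf {σ : ℝ | σ ∈ Set.Ioo 0 (muC α θ) ∧ TMCAttained p α θ σ}

/-- Hölder's inequality for two terms, with exponents `1/p` and `(p-1)/p`. -/
lemma add_rpow_mul_rpow_le {p : ℝ} (hp : 1 < p) {x y s d : ℝ} (hx : 0 ≤ x) (hy : 0 ≤ y)
    (hs : 0 ≤ s) (hd : 0 ≤ d) :
    x ^ (1 / p) * s ^ ((p - 1) / p) + y ^ (1 / p) * d ^ ((p - 1) / p) ≤
      (x + y) ^ (1 / p) * (s + d) ^ ((p - 1) / p) := by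
  have hp0 : 0 < p := by linarith
  have hp1 : 0 < p - 1 := by linarith
  have hpq : p.HolderConjugate (p / (p - 1)) := Real.HolderConjugate.conjExponent hp
  have h := Real.inner_le_Lp_mul_Lq_of_nonneg (Finset.univ : Finset (Fin 2))
    (f := ![x ^ (1 / p), y ^ (1 / p)]) (g := ![s ^ ((p - 1) / p), d ^ ((p - 1) / p)]) hpq
    (by intro i _; fin_cases i <;> simp <;> positivity)
    (by intro i _; fin_cases i <;> simp <;> positivity)
  have e1 : ∀ z : ℝ, 0 ≤ z → (z ^ (1 / p)) ^ p = z := fun z hz => by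
    rw [← Real.rpow_mul hz, one_div_mul_cancel hp0.ne', Real.rpow_one]
  have e2 : ∀ z : ℝ, 0 ≤ z → (z ^ ((p - 1) / p)) ^ (p / (p - 1)) = z := fun z hz => by
    rw [← Real.rpow_mul hz, div_mul_div_comm, mul_comm, div_self (by positivity), Real.rpow_one]
  simpa only [Fin.sum_univ_two, Matrix.cons_val_zero, Matrix.cons_val_one, e1 _ hx, e1 _ hy,
    e2 _ hs, e2 _ hd, one_div_div] using h

/-- `(x^{1/p} s^{(p-1)/p})^{p/(p-1)} ≤ (1 + (x-1)/(p-1)) s` (Bernoulli). -/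
lemma rpow_conj_le {p : ℝ} (hp : 2 ≤ p) {x s : ℝ} (hx : 0 ≤ x) (hs : 0 ≤ s) :
    (x ^ (1 / p) * s ^ ((p - 1) / p)) ^ (p / (p - 1)) ≤ (1 + (x - 1) / (p - 1)) * s := by
  have hp1 : 0 < p - 1 := by linarith
  have hp0 : 0 < p := by linarith
  rw [Real.mul_rpow (by positivity) (by positivity), ← Real.rpow_mul hx, ← Real.rpow_mul hs,
    div_mul_div_comm (p - 1), mul_comm (p - 1) p, div_self (by positivity), Real.rpow_one]
  refine mul_le_mul_of_nonneg_right ?_ hs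
  have h := rpow_one_add_le_one_add_mul_self (s := x - 1) (by linarith)
    (p := 1 / (p - 1)) (by positivity) (by rw [div_le_one hp1]; linarith)
  rw [show 1 + (x - 1) = x by ring] at h
  rw [show 1 / p * (p / (p - 1)) = 1 / (p - 1) by field_simp]
  calc _ ≤ _ := h
    _ = _ := by ring

/-- The increment hypotheses under which Moser's exponential estimate holds: `F` is a function on
`[h, ∞)` whose growth is controlled by the nondecreasing energy `e ≤ 1`. -/
structure EnergyControlled (p h : ℝ) (F e : ℝ → ℝ) : Prop where
  pos : 0 < h
  nonneg : ∀ t, h ≤ t → 0 ≤ F t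
  energy_nonneg : ∀ t, h ≤ t → 0 ≤ e t
  energy_le : ∀ t, h ≤ t → e t ≤ 1
  mono : ∀ s t, h ≤ s → s ≤ t → e s ≤ e t
  growth : ∀ t, h ≤ t → F t ≤ e t ^ (1 / p) * t ^ ((p - 1) / p)
  increment : ∀ s t, h ≤ s → s ≤ t →
    F t ≤ F s + (e t - e s) ^ (1 / p) * (t - s) ^ ((p - 1) / p)

namespace EnergyControlled

variable {p h : ℝ} {F e : ℝ → ℝ}

lemma rpow_le (hp : 2 ≤ p) (H : EnergyControlled p h F e) {t : ℝ} (ht : h ≤ t) :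
    F t ^ (p / (p - 1)) ≤ (1 + (e t - 1) / (p - 1)) * t := by
  have hp1 : 0 < p - 1 := by linarith
  exact (Real.rpow_le_rpow (H.nonneg t ht) (H.growth t ht) (by positivity)).trans
    (rpow_conj_le hp (H.energy_nonneg t ht) (H.pos.le.trans ht))

/-- Points of the sublevel set `{t - F^{p/(p-1)} ≤ l}` far from the origin are close together. -/
lemma sub_le (hp : 2 ≤ p) (H : EnergyControlled p h F e) {l s t : ℝ} (hl : 0 < l) (hs : h ≤ s)
    (hst : s ≤ t) (hsl : 2 * 2 ^ (p - 1) * l ≤ s) (hsm : s - F s ^ (p / (p - 1)) ≤ l)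
    (htm : t - F t ^ (p / (p - 1)) ≤ l) :
    t - s ≤ 4 * (1 + 2 ^ (p - 1)) * l := by
  have hp1 : 0 < p - 1 := by linarith
  have hp0 : 0 < p := by linarith
  have hs0 : 0 < s := H.pos.trans_le hs
  have ht := hs.trans hst
  set c : ℝ := 2 ^ (p - 1) with hc
  have hc0 : 0 < c := by positivity
  set x := e t - e s with hx
  have hx0 : 0 ≤ x := sub_nonneg.2 (H.mono s t hs hst)
  have hes : e s ≤ 1 - x := by have := H.energy_le t ht; linarith
  have hx1 : 0 ≤ 1 - x := (H.energy_nonneg s hs).trans hes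
  set d := t - s with hd
  have hd0 : 0 ≤ d := sub_nonneg.2 hst
  have hxs : x * s ≤ (p - 1) * l := by
    have h1 := H.rpow_le hp hs
    have h2 : (1 - e s) / (p - 1) * s ≤ l := by
      have : (1 - e s) / (p - 1) = -((e s - 1) / (p - 1)) := by ring
      rw [this]; nlinarith
    have h3 : (1 - e s) * s ≤ (p - 1) * l := by
      rw [div_mul_eq_mul_div, div_le_iff₀ hp1] at h2; linarith
    nlinarith
  have hxc : c * x * 2 ≤ p - 1 := by
    have : x * (2 * c * l) ≤ (p - 1) * l := (mul_le_mul_of_nonneg_left hsl hx0).trans hxs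
    have : (c * x * 2) * l ≤ (p - 1) * l := by linarith
    exact le_of_mul_le_mul_right this hl
  have hF : F t ≤ (1 + (c - 1) * x) ^ (1 / p) * (s + d / 2) ^ ((p - 1) / p) := by
    have h1 : F s ≤ (1 - x) ^ (1 / p) * s ^ ((p - 1) / p) :=
      (H.growth s hs).trans (mul_le_mul_of_nonneg_right
        (Real.rpow_le_rpow (H.energy_nonneg s hs) hes (by positivity)) (by positivity))
    have h2 : x ^ (1 / p) * d ^ ((p - 1) / p) =
        (c * x) ^ (1 / p) * (d / 2) ^ ((p - 1) / p) := by
      rw [Real.mul_rpow hc0.le hx0, Real.div_rpow hd0 (by norm_num), hc,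
        ← Real.rpow_mul (by norm_num), mul_one_div]
      field_simp
    have h3 := add_rpow_mul_rpow_le (p := p) (by linarith) hx1 (mul_nonneg hc0.le hx0) hs0.le
      (by positivity : 0 ≤ d / 2)
    have h4 := H.increment s t hs hst
    rw [h2] at h4
    rw [show 1 + (c - 1) * x = 1 - x + c * x by ring]
    linarith
  have h5 : F t ^ (p / (p - 1)) ≤ (1 + ((1 + (c - 1) * x) - 1) / (p - 1)) * (s + d / 2) :=
    (Real.rpow_le_rpow (H.nonneg t ht) hF (by positivity)).trans
      (rpow_conj_le hp (by linarith [mul_nonneg hc0.le hx0]) (by positivity))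
  have h6 : ((1 + (c - 1) * x) - 1) / (p - 1) * (s + d / 2) ≤ c * l + d / 4 := by
    rw [div_mul_eq_mul_div, div_le_iff₀ hp1]
    have h7 : c * (x * s) ≤ c * ((p - 1) * l) := mul_le_mul_of_nonneg_left hxs hc0.le
    have h8 : c * x * 2 * d ≤ (p - 1) * d := mul_le_mul_of_nonneg_right hxc hd0
    have h9 : 0 ≤ x * (s + d / 2) := by positivity
    nlinarith
  have h10 : t = s + d := by simp [hd]
  nlinarith

lemma volume_le (hp : 2 ≤ p) (H : EnergyControlled p h F e) {l : ℝ} (hl : 0 < l) :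
    volume {t | h ≤ t ∧ t - F t ^ (p / (p - 1)) ≤ l} ≤
      ENNReal.ofReal ((2 * 2 ^ (p - 1) + 4 * (1 + 2 ^ (p - 1))) * l) := by
  set a : ℝ := 2 * 2 ^ (p - 1) * l with ha
  set b : ℝ := 4 * (1 + 2 ^ (p - 1)) * l with hb
  have ha0 : 0 ≤ a := by positivity
  have hb0 : 0 ≤ b := by positivity
  set S := {t | h ≤ t ∧ t - F t ^ (p / (p - 1)) ≤ l}
  have hsub : S ⊆ Set.Icc 0 a ∪ (S ∩ Set.Ici a) := by
    intro t ht
    rcases le_total t a with h1 | h1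
    · exact Or.inl ⟨H.pos.le.trans ht.1, h1⟩
    · exact Or.inr ⟨ht, h1⟩
  have hdiam : volume (S ∩ Set.Ici a) ≤ ENNReal.ofReal b := by
    refine (Real.volume_le_diam _).trans (Metric.ediam_le ?_)
    intro s hs t ht
    rw [edist_dist, Real.dist_eq]
    refine ENNReal.ofReal_le_ofReal ?_
    rcases le_total s t with h1 | h1
    · rw [abs_sub_comm, abs_of_nonneg (by linarith)]
      exact H.sub_le hp hl hs.1.1 h1 hs.2 hs.1.2 ht.1.2
    · rw [abs_of_nonneg (by linarith)]
      exact H.sub_le hp hl ht.1.1 h1 ht.2 ht.1.2 hs.1.2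
  calc volume S ≤ volume (Set.Icc 0 a ∪ (S ∩ Set.Ici a)) := measure_mono hsub
    _ ≤ volume (Set.Icc 0 a) + volume (S ∩ Set.Ici a) := measure_union_le _ _
    _ ≤ ENNReal.ofReal a + ENNReal.ofReal b := by
      gcongr
      simp
    _ = _ := by rw [← ENNReal.ofReal_add ha0 hb0]; congr 1; ring

end EnergyControlled

/-- **Moser's one-dimensional exponential inequality.** -/
theorem exists_lintegral_exp_le {p : ℝ} (hp : 2 ≤ p) :
    ∃ C : ℝ≥0∞, C < ⊤ ∧ ∀ (h : ℝ) (F e : ℝ → ℝ), Measurable F → EnergyControlled p h F e →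
      ∫⁻ t in Set.Ici h, ENNReal.ofReal (Real.exp (F t ^ (p / (p - 1)) - t)) ≤ C := by
  set K : ℝ := 2 * 2 ^ (p - 1) + 4 * (1 + 2 ^ (p - 1)) with hK
  have hK0 : 0 ≤ K := by positivity
  refine ⟨∑' n : ℕ, ENNReal.ofReal (K * ((n + 1) * Real.exp (-1 * n))), ?_, ?_⟩
  · have hsum : Summable fun n : ℕ => K * (((n : ℝ) + 1) * Real.exp (-1 * n)) := by
      refine Summable.mul_left _ ?_
      have h1 := (Real.summable_pow_mul_exp_neg_nat_mul 1 one_pos).add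
        (Real.summable_pow_mul_exp_neg_nat_mul 0 one_pos)
      refine h1.congr fun n => ?_
      ring
    rw [← ENNReal.ofReal_tsum_of_nonneg (fun n => by positivity) hsum]
    exact ENNReal.ofReal_lt_top
  · intro h F e hF H
    set g : ℝ → ℝ := fun t => t - F t ^ (p / (p - 1)) with hg
    have hgm : Measurable g := by fun_prop
    set S : ℕ → Set ℝ := fun n => {t | h ≤ t ∧ (n : ℝ) ≤ g t ∧ g t < n + 1} with hS
    have hSm : ∀ n, MeasurableSet (S n) := fun n =>
      measurableSet_Ici.inter ((hgm measurableSet_Ici).inter (hgm measurableSet_Iio))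
    have hcov : Set.Ici h ⊆ ⋃ n, S n := by
      intro t ht
      have hg0 : 0 ≤ g t := by
        have h1 := H.rpow_le hp ht
        have h2 : (e t - 1) / (p - 1) ≤ 0 :=
          div_nonpos_of_nonpos_of_nonneg (by linarith [H.energy_le t ht]) (by linarith)
        have h3 : 0 ≤ t := H.pos.le.trans ht
        simp only [hg]
        nlinarith
      exact Set.mem_iUnion.2 ⟨⌊g t⌋₊, ht, Nat.floor_le hg0, Nat.lt_floor_add_one _⟩
    calc _ ≤ ∫⁻ t in ⋃ n, S n, ENNReal.ofReal (Real.exp (F t ^ (p / (p - 1)) - t)) :=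
          lintegral_mono_set hcov
      _ ≤ ∑' n, ∫⁻ t in S n, ENNReal.ofReal (Real.exp (F t ^ (p / (p - 1)) - t)) :=
          lintegral_iUnion_le _ _
      _ ≤ _ := ENNReal.tsum_le_tsum fun n => ?_
    calc _ ≤ ∫⁻ t in S n, ENNReal.ofReal (Real.exp (-1 * n)) := by
          refine setLIntegral_mono' (hSm n) fun t ht => ENNReal.ofReal_le_ofReal ?_
          have := ht.2.1
          simp only [hg] at this
          exact Real.exp_le_exp.2 (by linarith)
      _ = ENNReal.ofReal (Real.exp (-1 * n)) * volume (S n) := setLIntegral_const _ _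
      _ ≤ ENNReal.ofReal (Real.exp (-1 * n)) * ENNReal.ofReal (K * (n + 1)) := by
          gcongr
          refine (measure_mono ?_).trans (H.volume_le hp (by positivity : (0 : ℝ) < n + 1))
          exact fun t ht => ⟨ht.1, ht.2.2.le⟩
      _ = _ := by
          rw [← ENNReal.ofReal_mul (by positivity)]
          congr 1
          ring

lemma omegaW_pos {θ : ℝ} (hθ : 0 ≤ θ) : 0 < omegaW θ := by
  have := Real.Gamma_pos_of_pos (show 0 < (θ + 1) / 2 by linarith)
  unfold omegaW
  positivity

lemma summable_phiP (p t : ℝ) (ht : 0 ≤ t) :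
    Summable fun j : ℕ => if p - 1 ≤ (j : ℝ) then t ^ j / (Nat.factorial j : ℝ) else 0 := by
  refine Summable.of_nonneg_of_le (fun j => ?_) (fun j => ?_) (Real.summable_pow_div_factorial t)
  · split_ifs <;> positivity
  · split_ifs
    · exact le_rfl
    · positivity

lemma tsum_pow_div_factorial (t : ℝ) : ∑' j : ℕ, t ^ j / (Nat.factorial j : ℝ) = Real.exp t := by
  rw [Real.exp_eq_exp_ℝ]
  exact (NormedSpace.expSeries_div_hasSum_exp t).tsum_eq

lemma phiP_le_exp (p : ℝ) {t : ℝ} (ht : 0 ≤ t) : phiP p t ≤ Real.exp t := by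
  rw [← tsum_pow_div_factorial]
  refine (summable_phiP p t ht).tsum_le_tsum (fun j => ?_) (Real.summable_pow_div_factorial t)
  split_ifs
  · exact le_rfl
  · positivity

lemma phiP_le_of_le {p t T : ℝ} (hp : 1 ≤ p) (ht : 0 ≤ t) (hT : 0 < T) (htT : t ≤ T) :
    phiP p t ≤ (t / T) ^ (p - 1) * Real.exp T := by
  rw [← tsum_pow_div_factorial, ← tsum_mul_left, phiP]
  refine (summable_phiP p t ht).tsum_le_tsum (fun j => ?_)
    ((Real.summable_pow_div_factorial T).mul_left _)
  split_ifs with hj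
  · have h1 : t ^ j = (t / T) ^ (j : ℝ) * T ^ j := by
      rw [Real.rpow_natCast, div_pow, div_mul_cancel₀ _ (by positivity)]
    rw [h1, mul_div_assoc]
    refine mul_le_mul_of_nonneg_right ?_ (by positivity)
    exact Real.rpow_le_rpow_of_exponent_ge' (by positivity) ((div_le_one hT).2 htT)
      (by linarith) hj
  · positivity

/-- The weighted integral over a subset of `(0, ∞)`. -/
noncomputable def wIntOn (θ : ℝ) (f : ℝ → ℝ) (s : Set ℝ) : ℝ≥0∞ :=
  ENNReal.ofReal (omegaW θ) * ∫⁻ r in s, ENNReal.ofReal (f r) * ENNReal.ofReal (r ^ θ)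

lemma wIntOn_mono (θ : ℝ) (f : ℝ → ℝ) {s t : Set ℝ} (h : s ⊆ t) :
    wIntOn θ f s ≤ wIntOn θ f t :=
  mul_le_mul_right (lintegral_mono_set h) _

lemma wIntOn_le_wInt (θ : ℝ) (f : ℝ → ℝ) {s : Set ℝ} (h : s ⊆ Set.Ioi 0) :
    wIntOn θ f s ≤ wInt θ f :=
  wIntOn_mono θ f h

lemma wIntOn_Ioc_add (θ : ℝ) (f : ℝ → ℝ) {a b c : ℝ} (hab : a ≤ b) (hbc : b ≤ c) :
    wIntOn θ f (Set.Ioc a c) = wIntOn θ f (Set.Ioc a b) + wIntOn θ f (Set.Ioc b c) := by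
  rw [wIntOn, wIntOn, wIntOn, ← mul_add, ← lintegral_union measurableSet_Ioc
    (Set.Ioc_disjoint_Ioc_of_le le_rfl), Set.Ioc_union_Ioc_eq_Ioc hab hbc]

lemma lintegral_inv_Ioc {a b : ℝ} (ha : 0 < a) (hab : a ≤ b) :
    ∫⁻ r in Set.Ioc a b, ENNReal.ofReal r⁻¹ = ENNReal.ofReal (Real.log (b / a)) := by
  have hb := ha.trans_le hab
  rw [← integral_inv_of_pos ha hb, intervalIntegral.integral_of_le hab,
    ofReal_integral_eq_lintegral_ofReal]
  · refine (intervalIntegrable_iff_integrableOn_Ioc_of_le hab).1 ?_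
    refine intervalIntegral.intervalIntegrable_inv (fun x hx => ?_) continuousOn_id
    rw [Set.uIcc_of_le hab] at hx
    exact (ha.trans_le hx.1).ne'
  · refine (ae_restrict_iff' measurableSet_Ioc).2 (ae_of_all _ fun x hx => ?_)
    exact inv_nonneg.2 (ha.trans hx.1).le

namespace MemX

variable {p θ : ℝ} {u u' : ℝ → ℝ}

lemma continuousOn {α : ℝ} (H : MemX p α θ u u') : ContinuousOn u (Set.Ioi 0) := by
  intro x hx
  have hx0 : 0 < x := hx
  have hle : x / 2 ≤ 2 * x := by linarith
  have h1 := intervalIntegral.continuousOn_primitive_interval'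
    (H.ftc_int (x / 2) (2 * x) (by positivity) hle) Set.left_mem_uIcc
  rw [Set.uIcc_of_le hle] at h1
  have h2 : ContinuousAt (fun b => u (x / 2) + ∫ t in (x / 2)..b, u' t) x :=
    continuousAt_const.add (h1.continuousAt (Icc_mem_nhds (by linarith) (by linarith)))
  refine (h2.congr ?_).continuousWithinAt
  filter_upwards [Ioi_mem_nhds (show x / 2 < x by linarith)] with y hy
  rw [← H.ftc (x / 2) y (by positivity) (le_of_lt hy)]
  ring

lemma ofReal_abs_sub_le (hp : 2 ≤ p) (H : MemX p (p - 1) θ u u') {a b : ℝ} (ha : 0 < a)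
    (hab : a ≤ b) :
    ENNReal.ofReal |u b - u a| ≤
      (∫⁻ r in Set.Ioc a b, ENNReal.ofReal (|u' r| ^ p) * ENNReal.ofReal (r ^ (p - 1))) ^ (1 / p) *
        ENNReal.ofReal (Real.log (b / a)) ^ ((p - 1) / p) := by
  have hp0 : 0 < p := by linarith
  have hp1 : 0 < p - 1 := by linarith
  have hpq : p.HolderConjugate (p / (p - 1)) := Real.HolderConjugate.conjExponent (by linarith)
  have hint := (intervalIntegrable_iff_integrableOn_Ioc_of_le hab).1 (H.ftc_int a b ha hab)
  have hm : AEMeasurable u' (volume.restrict (Set.Ioc a b)) := hint.aestronglyMeasurable.aemeasurable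
  have h1 : ENNReal.ofReal |u b - u a| ≤ ∫⁻ r in Set.Ioc a b, ‖u' r‖ₑ := by
    rw [H.ftc a b ha hab, intervalIntegral.integral_of_le hab, ← Real.enorm_eq_ofReal_abs]
    exact enorm_integral_le_lintegral_enorm _
  have h2 : ∫⁻ r in Set.Ioc a b, ‖u' r‖ₑ = ∫⁻ r in Set.Ioc a b,
      ((fun r => ENNReal.ofReal (|u' r| * r ^ ((p - 1) / p))) *
        fun r => ENNReal.ofReal (r ^ (-((p - 1) / p)))) r := by
    refine setLIntegral_congr_fun measurableSet_Ioc fun r hr => ?_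
    have hr0 : 0 < r := ha.trans hr.1
    simp only [Pi.mul_apply]
    rw [← ENNReal.ofReal_mul (by positivity), mul_assoc, ← Real.rpow_add hr0, add_neg_cancel,
      Real.rpow_zero, mul_one, Real.enorm_eq_ofReal_abs]
  have h3 := ENNReal.lintegral_mul_le_Lp_mul_Lq (volume.restrict (Set.Ioc a b)) hpq
    (f := fun r => ENNReal.ofReal (|u' r| * r ^ ((p - 1) / p)))
    (g := fun r => ENNReal.ofReal (r ^ (-((p - 1) / p))))
    (ENNReal.measurable_ofReal.comp_aemeasurable
      (hm.abs.mul (measurable_id.pow_const _).aemeasurable))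
    (by fun_prop)
  refine h1.trans (h2.le.trans (h3.trans (le_of_eq ?_)))
  rw [one_div_div]
  congr 2
  · refine setLIntegral_congr_fun measurableSet_Ioc fun r hr => ?_
    have hr0 : 0 < r := ha.trans hr.1
    rw [← ENNReal.ofReal_mul (by positivity), ENNReal.ofReal_rpow_of_nonneg (by positivity) hp0.le,
      Real.mul_rpow (by positivity) (by positivity), ← Real.rpow_mul hr0.le,
      div_mul_cancel₀ _ hp0.ne']
  · rw [← lintegral_inv_Ioc ha hab]
    refine setLIntegral_congr_fun measurableSet_Ioc fun r hr => ?_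
    have hr0 : 0 < r := ha.trans hr.1
    rw [ENNReal.ofReal_rpow_of_nonneg (by positivity) (by positivity), ← Real.rpow_mul hr0.le,
      neg_mul, div_mul_div_comm, mul_comm p, div_self (by positivity), Real.rpow_neg_one]

lemma abs_sub_le (hp : 2 ≤ p) (H : MemX p (p - 1) θ u u')
    (hfin : wInt (p - 1) (fun r => |u' r| ^ p) ≠ ⊤) {a b : ℝ} (ha : 0 < a) (hab : a ≤ b) :
    |u b - u a| ≤
      ((wIntOn (p - 1) (fun r => |u' r| ^ p) (Set.Ioc a b)).toReal / omegaW (p - 1)) ^ (1 / p) *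
        Real.log (b / a) ^ ((p - 1) / p) := by
  have hp0 : 0 < p := by linarith
  have hp1 : 0 < p - 1 := by linarith
  have hω := omegaW_pos hp1.le
  have hlog : 0 ≤ Real.log (b / a) := Real.log_nonneg ((one_le_div ha).2 hab)
  have h := H.ofReal_abs_sub_le hp ha hab
  have hfin' : wIntOn (p - 1) (fun r => |u' r| ^ p) (Set.Ioc a b) ≠ ⊤ :=
    ne_top_of_le_ne_top hfin (wIntOn_le_wInt _ _ fun r hr => ha.trans hr.1)
  have hI : ∫⁻ r in Set.Ioc a b, ENNReal.ofReal (|u' r| ^ p) * ENNReal.ofReal (r ^ (p - 1)) =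
      ENNReal.ofReal
        ((wIntOn (p - 1) (fun r => |u' r| ^ p) (Set.Ioc a b)).toReal / omegaW (p - 1)) := by
    rw [ENNReal.ofReal_div_of_pos hω, ENNReal.ofReal_toReal hfin', wIntOn,
      mul_comm (ENNReal.ofReal _), ENNReal.mul_div_cancel_right (by simpa using hω) ENNReal.ofReal_ne_top]
  rw [hI, ENNReal.ofReal_rpow_of_nonneg (by positivity) (by positivity),
    ENNReal.ofReal_rpow_of_nonneg hlog (by positivity), ← ENNReal.ofReal_mul (by positivity)] at h
  exact (ENNReal.ofReal_le_ofReal_iff (by positivity)).1 h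

/-- Every interval `[r, r+1]` with `r ≥ 1` contains a point where `|u|^p` is at most its average. -/
lemma exists_abs_rpow_le {α : ℝ} (hp : 2 ≤ p) (hθ : 0 ≤ θ) (H : MemX p α θ u u')
    (hfin : wInt θ (fun r => |u r| ^ p) ≠ ⊤) {r : ℝ} (hr : 1 ≤ r) :
    ∃ s ∈ Set.Icc r (r + 1),
      |u s| ^ p ≤ (wInt θ (fun r => |u r| ^ p)).toReal / omegaW θ := by
  have hω := omegaW_pos hθ
  have hpos : Set.Icc r (r + 1) ⊆ Set.Ioi (0 : ℝ) := fun x hx => one_pos.trans_le (hr.trans hx.1)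
  have hcont : ContinuousOn (fun x => |u x| ^ p) (Set.Icc r (r + 1)) :=
    ((H.continuousOn.mono hpos).abs).rpow_const fun _ _ => Or.inr (by linarith)
  have hvol : volume (Set.Icc r (r + 1)) = 1 := by simp
  obtain ⟨s, hs, hle⟩ := exists_le_setLAverage (μ := volume) (s := Set.Icc r (r + 1))
    (f := fun x => ENNReal.ofReal (|u x| ^ p)) (by simp [hvol]) (by simp [hvol])
    (ENNReal.measurable_ofReal.comp_aemeasurable (hcont.aemeasurable measurableSet_Icc))
  refine ⟨s, hs, ?_⟩
  rw [setLAverage_eq, hvol, div_one] at hle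
  have h1 : ∫⁻ x in Set.Icc r (r + 1), ENNReal.ofReal (|u x| ^ p) ≤
      wInt θ (fun r => |u r| ^ p) / ENNReal.ofReal (omegaW θ) := by
    have h2 : ∫⁻ x in Set.Icc r (r + 1), ENNReal.ofReal (|u x| ^ p) ≤
        ∫⁻ x in Set.Icc r (r + 1), ENNReal.ofReal (|u x| ^ p) * ENNReal.ofReal (x ^ θ) := by
      refine setLIntegral_mono' measurableSet_Icc fun x hx => le_mul_of_one_le_right zero_le ?_
      exact ENNReal.one_le_ofReal.2 (Real.one_le_rpow (hr.trans hx.1) hθ)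
    refine h2.trans ((lintegral_mono_set hpos).trans (le_of_eq ?_))
    rw [wInt, mul_comm (ENNReal.ofReal _), ENNReal.mul_div_cancel_right (by simpa using hω) ENNReal.ofReal_ne_top]
  rw [← ENNReal.ofReal_toReal hfin, ← ENNReal.ofReal_div_of_pos hω] at h1
  exact (ENNReal.ofReal_le_ofReal_iff (by positivity)).1 (hle.trans h1)

end MemX

lemma muC_pos {α θ : ℝ} (hα : 0 ≤ α) (hθ : 0 ≤ θ) : 0 < muC α θ := by
  have := omegaW_pos hα
  unfold muC
  positivity

lemma Xnorm_le_one_iff {p α θ : ℝ} (hp : 0 < p) {u u' : ℝ → ℝ} :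
    Xnorm p α θ u u' ≤ 1 ↔
      wInt θ (fun r => |u r| ^ p) + wInt α (fun r => |u' r| ^ p) ≤ 1 := by
  have h : ∀ x : ℝ≥0∞, (x ^ (1 / p)) ^ p = x := fun x => by
    rw [← ENNReal.rpow_mul, one_div_mul_cancel hp.ne', ENNReal.rpow_one]
  rw [Xnorm, wNorm, wNorm, h, h, ← ENNReal.one_rpow (1 / p),
    ENNReal.rpow_le_rpow_iff (by positivity), ENNReal.one_rpow]

/-- The logarithmic change of variables `r = r₁ e^{-τ/(θ+1)}`. -/
noncomputable def logVar (θ r₁ τ : ℝ) : ℝ := r₁ * Real.exp (-τ / (θ + 1))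

section logVar

variable {θ r₁ : ℝ}

lemma logVar_pos (hr : 0 < r₁) (τ : ℝ) : 0 < logVar θ r₁ τ :=
  mul_pos hr (Real.exp_pos _)

lemma continuous_logVar : Continuous (logVar θ r₁) := by
  unfold logVar
  fun_prop

lemma logVar_antitone (hθ : 0 ≤ θ) (hr : 0 < r₁) : Antitone (logVar θ r₁) := by
  intro s t hst
  unfold logVar
  gcongr

lemma log_logVar_div (hr : 0 < r₁) (s t : ℝ) :
    Real.log (logVar θ r₁ s / logVar θ r₁ t) = (t - s) / (θ + 1) := by
  rw [logVar, logVar, mul_div_mul_left _ _ hr.ne', ← Real.exp_sub, Real.log_exp]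
  ring

lemma logVar_injective (hθ : 0 ≤ θ) (hr : 0 < r₁) : Function.Injective (logVar θ r₁) := by
  intro s t hst
  have h := log_logVar_div (θ := θ) hr s t
  rw [hst, div_self (logVar_pos hr t).ne', Real.log_one, eq_comm, _root_.div_eq_zero_iff] at h
  rcases h with h | h <;> linarith

lemma hasDerivAt_logVar (τ : ℝ) :
    HasDerivAt (logVar θ r₁) (-(logVar θ r₁ τ / (θ + 1))) τ := by
  have h := (((hasDerivAt_id τ).neg.div_const (θ + 1)).exp).const_mul r₁
  unfold logVar
  refine h.congr_deriv ?_
  simp only [id, Pi.neg_apply]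
  ring

lemma Ioc_subset_image_logVar (hθ : 0 ≤ θ) (hr : 0 < r₁) (h : ℝ) :
    Set.Ioc 0 (logVar θ r₁ h) ⊆ logVar θ r₁ '' Set.Ici h := by
  intro x hx
  have hθ1 : 0 < θ + 1 := by linarith
  have hτ : logVar θ r₁ (-(θ + 1) * Real.log (x / r₁)) = x := by
    rw [logVar, show -(-(θ + 1) * Real.log (x / r₁)) / (θ + 1) = Real.log (x / r₁) by field_simp,
      Real.exp_log (div_pos hx.1 hr), mul_div_cancel₀ _ hr.ne']
  refine ⟨_, ?_, hτ⟩
  by_contra hlt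
  have h1 := logVar_antitone hθ hr (not_le.1 hlt).le
  rw [hτ] at h1
  have h2 : x = logVar θ r₁ h := le_antisymm hx.2 h1
  exact hlt (logVar_injective hθ hr (hτ.trans h2)).ge

lemma logVar_rpow (hθ : 0 ≤ θ) (hr : 0 < r₁) (τ : ℝ) :
    logVar θ r₁ τ ^ (θ + 1) = r₁ ^ (θ + 1) * Real.exp (-τ) := by
  rw [logVar, Real.mul_rpow hr.le (Real.exp_pos _).le, ← Real.exp_mul,
    div_mul_cancel₀ _ (by linarith)]

/-- Change of variables for weighted integrals near the origin. -/
lemma lintegral_Ioc_logVar_le (hθ : 0 ≤ θ) (hr : 0 < r₁) (h : ℝ) (g : ℝ → ℝ) :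
    ∫⁻ r in Set.Ioc 0 (logVar θ r₁ h), ENNReal.ofReal (Real.exp (g r)) * ENNReal.ofReal (r ^ θ) ≤
      ENNReal.ofReal (r₁ ^ (θ + 1) / (θ + 1)) *
        ∫⁻ τ in Set.Ici h, ENNReal.ofReal (Real.exp (g (logVar θ r₁ τ) - τ)) := by
  have hθ1 : 0 < θ + 1 := by linarith
  refine (lintegral_mono_set (Ioc_subset_image_logVar hθ hr h)).trans (le_of_eq ?_)
  rw [lintegral_image_eq_lintegral_abs_deriv_mul measurableSet_Ici
    (fun τ _ => (hasDerivAt_logVar τ).hasDerivWithinAt) (logVar_injective hθ hr).injOn,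
    ← lintegral_const_mul' _ _ ENNReal.ofReal_ne_top]
  refine lintegral_congr fun τ => ?_
  have h0 := logVar_pos (θ := θ) hr τ
  rw [← ENNReal.ofReal_mul (by positivity), ← ENNReal.ofReal_mul (by positivity),
    ← ENNReal.ofReal_mul (by positivity), abs_neg, abs_of_pos (by positivity)]
  congr 1
  have h1 : logVar θ r₁ τ * logVar θ r₁ τ ^ θ = r₁ ^ (θ + 1) * Real.exp (-τ) := by
    rw [← logVar_rpow hθ hr, Real.rpow_add_one h0.ne', mul_comm]
  rw [sub_eq_add_neg, Real.exp_add]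
  calc _ = (logVar θ r₁ τ * logVar θ r₁ τ ^ θ) * Real.exp (g (logVar θ r₁ τ)) / (θ + 1) := by ring
    _ = _ := by rw [h1]; ring

end logVar

namespace MemX

variable {p θ : ℝ} {u u' : ℝ → ℝ}

/-- Functions in the unit ball are uniformly bounded on `[1, ∞)`. -/
lemma abs_le (hp : 2 ≤ p) (hθ : 0 ≤ θ) (H : MemX p (p - 1) θ u u')
    (hN : wInt θ (fun r => |u r| ^ p) + wInt (p - 1) (fun r => |u' r| ^ p) ≤ 1)
    {r : ℝ} (hr : 1 ≤ r) :
    |u r| ≤ (1 / omegaW θ) ^ (1 / p) + (1 / omegaW (p - 1)) ^ (1 / p) := by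
  have hp0 : 0 < p := by linarith
  have hp1 : 0 < p - 1 := by linarith
  have hω := omegaW_pos hθ
  have hω' := omegaW_pos hp1.le
  have hB := le_self_add.trans hN
  have hA := le_add_self.trans hN
  have hr0 : 0 < r := by linarith
  obtain ⟨s, hs, hsle⟩ := H.exists_abs_rpow_le hp hθ (ne_top_of_le_ne_top ENNReal.one_ne_top hB) hr
  have h1 : |u s| ≤ (1 / omegaW θ) ^ (1 / p) := by
    rw [one_div p, Real.le_rpow_inv_iff_of_pos (abs_nonneg _) (by positivity) hp0]
    refine hsle.trans (div_le_div_of_nonneg_right ?_ hω.le)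
    exact ENNReal.toReal_le_of_le_ofReal zero_le_one (by simpa using hB)
  have h2 : |u s - u r| ≤ (1 / omegaW (p - 1)) ^ (1 / p) := by
    refine (H.abs_sub_le hp (ne_top_of_le_ne_top ENNReal.one_ne_top hA) hr0 hs.1).trans ?_
    rw [← mul_one ((1 / omegaW (p - 1)) ^ (1 / p))]
    have hlog0 : 0 ≤ Real.log (s / r) := Real.log_nonneg ((one_le_div hr0).2 hs.1)
    have hlog1 : Real.log (s / r) ≤ 1 := by
      have h3 : s / r ≤ 2 := by rw [div_le_iff₀ hr0]; linarith [hs.2]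
      have h4 : 0 < s / r := div_pos (hr0.trans_le hs.1) hr0
      linarith [Real.log_le_sub_one_of_pos h4]
    refine mul_le_mul (Real.rpow_le_rpow (by positivity) ?_ (by positivity))
      (Real.rpow_le_one hlog0 hlog1 (by positivity)) (by positivity) (by positivity)
    refine div_le_div_of_nonneg_right ?_ hω'.le
    refine ENNReal.toReal_le_of_le_ofReal zero_le_one ?_
    simpa using (wIntOn_le_wInt _ _ fun x hx => hr0.trans hx.1).trans hA
  have h3 := abs_sub_abs_le_abs_sub (u r) (u s)
  rw [abs_sub_comm] at h3
  linarith

/-- In logarithmic variables, functions in the unit ball are controlled by their energy,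
the boundary value being absorbed by the `L^p_θ` part of the norm. -/
lemma energyControlled (hp : 2 ≤ p) (hθ : 0 ≤ θ) (H : MemX p (p - 1) θ u u')
    (hN : wInt θ (fun r => |u r| ^ p) + wInt (p - 1) (fun r => |u' r| ^ p) ≤ 1)
    {r₁ h : ℝ} (hr : 0 < r₁) (hh : h = muC (p - 1) θ * omegaW θ ^ (-(1 / (p - 1))))
    (hle : |u (logVar θ r₁ h)| ^ p ≤ (wInt θ (fun r => |u r| ^ p)).toReal / omegaW θ) :
    EnergyControlled p h (fun τ => muC (p - 1) θ ^ ((p - 1) / p) * |u (logVar θ r₁ τ)|)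
      (fun τ => (wInt θ (fun r => |u r| ^ p)).toReal +
        (wIntOn (p - 1) (fun r => |u' r| ^ p) (Set.Ioc (logVar θ r₁ τ) (logVar θ r₁ h))).toReal) := by
  have hp0 : 0 < p := by linarith
  have hp1 : 0 < p - 1 := by linarith
  have hθ1 : 0 < θ + 1 := by linarith
  have hω := omegaW_pos hθ
  have hω' := omegaW_pos hp1.le
  have hμ := muC_pos hp1.le hθ
  have hh0 : 0 < h := by rw [hh]; positivity
  have hB : wInt θ (fun r => |u r| ^ p) ≠ ⊤ :=
    ne_top_of_le_ne_top ENNReal.one_ne_top (le_self_add.trans hN)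
  have hA : wInt (p - 1) (fun r => |u' r| ^ p) ≠ ⊤ :=
    ne_top_of_le_ne_top ENNReal.one_ne_top (le_add_self.trans hN)
  have hpos := logVar_pos (θ := θ) hr
  have hanti := logVar_antitone hθ hr
  have hfin : ∀ s t, wIntOn (p - 1) (fun r => |u' r| ^ p)
      (Set.Ioc (logVar θ r₁ t) (logVar θ r₁ s)) ≠ ⊤ := fun s t =>
    ne_top_of_le_ne_top hA (wIntOn_le_wInt _ _ fun x hx => (hpos t).trans hx.1)
  set B := (wInt θ (fun r => |u r| ^ p)).toReal with hBdef
  set E : ℝ → ℝ → ℝ := fun s t => (wIntOn (p - 1) (fun r => |u' r| ^ p)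
      (Set.Ioc (logVar θ r₁ t) (logVar θ r₁ s))).toReal with hE
  have hE0 : ∀ s t, 0 ≤ E s t := fun s t => ENNReal.toReal_nonneg
  have hadd : ∀ s t, h ≤ s → s ≤ t → E h t = E s t + E h s := by
    intro s t hs hst
    simp only [hE]
    rw [← ENNReal.toReal_add (hfin _ _) (hfin _ _), ← wIntOn_Ioc_add _ _ (hanti hst) (hanti hs)]
  have hincr : ∀ s t, s ≤ t →
      muC (p - 1) θ ^ ((p - 1) / p) * |u (logVar θ r₁ t)| ≤
        muC (p - 1) θ ^ ((p - 1) / p) * |u (logVar θ r₁ s)| +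
          E s t ^ (1 / p) * (t - s) ^ ((p - 1) / p) := by
    intro s t hst
    have h1 := H.abs_sub_le hp hA (hpos t) (hanti hst)
    rw [log_logVar_div hr, Real.div_rpow (hE0 s t) hω'.le,
      Real.div_rpow (sub_nonneg.2 hst) hθ1.le] at h1
    have h2 : muC (p - 1) θ ^ ((p - 1) / p) =
        (θ + 1) ^ ((p - 1) / p) * omegaW (p - 1) ^ (1 / p) := by
      rw [muC, Real.mul_rpow hθ1.le (by positivity), ← Real.rpow_mul hω'.le]
      congr 2
      field_simp
    have h3 := abs_sub_abs_le_abs_sub (u (logVar θ r₁ t)) (u (logVar θ r₁ s))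
    rw [abs_sub_comm] at h3
    have h4 : muC (p - 1) θ ^ ((p - 1) / p) *
        (|u (logVar θ r₁ t)| - |u (logVar θ r₁ s)|) ≤ E s t ^ (1 / p) * (t - s) ^ ((p - 1) / p) := by
      calc _ ≤ muC (p - 1) θ ^ ((p - 1) / p) * (E s t ^ (1 / p) / omegaW (p - 1) ^ (1 / p) *
            ((t - s) ^ ((p - 1) / p) / (θ + 1) ^ ((p - 1) / p))) :=
            mul_le_mul_of_nonneg_left (h3.trans h1) (by positivity)
        _ = _ := by
            rw [h2]
            have : 0 < (θ + 1) ^ ((p - 1) / p) := by positivity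
            have : 0 < omegaW (p - 1) ^ (1 / p) := by positivity
            field_simp
    linarith
  have hstart : muC (p - 1) θ ^ ((p - 1) / p) * |u (logVar θ r₁ h)| ≤
      B ^ (1 / p) * h ^ ((p - 1) / p) := by
    have h1 : |u (logVar θ r₁ h)| ≤ (B / omegaW θ) ^ (1 / p) := by
      rw [one_div p, Real.le_rpow_inv_iff_of_pos (abs_nonneg _) (by positivity) hp0]
      exact hle
    have h2 : h ^ ((p - 1) / p) = muC (p - 1) θ ^ ((p - 1) / p) / omegaW θ ^ (1 / p) := by
      rw [hh, Real.mul_rpow hμ.le (by positivity), ← Real.rpow_mul hω.le,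
        show -(1 / (p - 1)) * ((p - 1) / p) = -(1 / p) by field_simp, Real.rpow_neg hω.le]
      ring
    rw [h2]
    calc _ ≤ muC (p - 1) θ ^ ((p - 1) / p) * (B / omegaW θ) ^ (1 / p) :=
          mul_le_mul_of_nonneg_left h1 (by positivity)
      _ = _ := by rw [Real.div_rpow ENNReal.toReal_nonneg hω.le]; ring
  refine ⟨hh0, fun t _ => by positivity, fun t _ => by positivity, fun t _ => ?_,
    fun s t hs hst => ?_, fun t ht => ?_, fun s t hs hst => ?_⟩
  · change B + E h t ≤ 1
    rw [← ENNReal.toReal_add hB (hfin _ _)]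
    refine ENNReal.toReal_le_of_le_ofReal zero_le_one ?_
    rw [ENNReal.ofReal_one]
    exact (add_le_add_right (wIntOn_le_wInt _ _ fun x hx => (hpos t).trans hx.1) _).trans hN
  · change B + E h s ≤ B + E h t
    linarith [hadd s t hs hst, hE0 s t]
  · change _ ≤ (B + E h t) ^ (1 / p) * _
    have h1 := add_rpow_mul_rpow_le (p := p) (by linarith) (ENNReal.toReal_nonneg : 0 ≤ B)
      (hE0 h t) hh0.le (sub_nonneg.2 ht)
    rw [add_sub_cancel] at h1
    linarith [hincr h t ht]
  · change _ ≤ _ + ((B + E h t) - (B + E h s)) ^ (1 / p) * _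
    rw [hadd s t hs hst, show B + (E s t + E h s) - (B + E h s) = E s t by ring]
    exact hincr s t hst

/-- The part of the Trudinger–Moser functional near infinity. -/
lemma wIntOn_phiP_Ioi_le (hp : 2 ≤ p) (hθ : 0 ≤ θ) (H : MemX p (p - 1) θ u u')
    (hN : wInt θ (fun r => |u r| ^ p) + wInt (p - 1) (fun r => |u' r| ^ p) ≤ 1)
    {σ T a : ℝ} (hσ : 0 ≤ σ) (ha : 1 ≤ a)
    (hT : T = σ * ((1 / omegaW θ) ^ (1 / p) + (1 / omegaW (p - 1)) ^ (1 / p)) ^ (p / (p - 1)) + 1) :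
    wIntOn θ (fun r => phiP p (σ * |u r| ^ (p / (p - 1)))) (Set.Ioi a) ≤
      ENNReal.ofReal ((σ / T) ^ (p - 1) * Real.exp T) := by
  have hp0 : 0 < p := by linarith
  have hp1 : 0 < p - 1 := by linarith
  have hω := omegaW_pos hθ
  have hω' := omegaW_pos hp1.le
  have hT0 : 0 < T := by rw [hT]; positivity
  set D := (σ / T) ^ (p - 1) * Real.exp T with hD
  have hD0 : 0 ≤ D := by positivity
  have hpt : ∀ r ∈ Set.Ioi a, phiP p (σ * |u r| ^ (p / (p - 1))) ≤ D * |u r| ^ p := by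
    intro r hr
    have hr1 : 1 ≤ r := ha.trans (le_of_lt hr)
    refine (phiP_le_of_le (by linarith) (by positivity) hT0 ?_).trans (le_of_eq ?_)
    · rw [hT]
      have := Real.rpow_le_rpow (abs_nonneg _) (H.abs_le hp hθ hN hr1)
        (by positivity : 0 ≤ p / (p - 1))
      nlinarith
    · rw [mul_div_right_comm, Real.mul_rpow (by positivity) (by positivity),
        ← Real.rpow_mul (abs_nonneg _), div_mul_cancel₀ _ hp1.ne', hD]
      ring
  calc _ ≤ ENNReal.ofReal (omegaW θ) * ∫⁻ r in Set.Ioi a,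
        ENNReal.ofReal D * (ENNReal.ofReal (|u r| ^ p) * ENNReal.ofReal (r ^ θ)) := by
        refine mul_le_mul_right (setLIntegral_mono' measurableSet_Ioi fun r hr => ?_) _
        rw [← mul_assoc, ← ENNReal.ofReal_mul hD0]
        exact mul_le_mul_left (ENNReal.ofReal_le_ofReal (hpt r hr)) _
    _ = ENNReal.ofReal D * wIntOn θ (fun r => |u r| ^ p) (Set.Ioi a) := by
        rw [lintegral_const_mul' _ _ ENNReal.ofReal_ne_top, wIntOn]
        ring
    _ ≤ ENNReal.ofReal D * 1 := by
        refine mul_le_mul_right ?_ _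
        exact (wIntOn_le_wInt _ _ fun x hx => one_pos.trans_le (ha.trans (le_of_lt hx))).trans
          (le_self_add.trans hN)
    _ = _ := mul_one _

end MemX

lemma TMfunc_eq_add (p θ σ : ℝ) (u : ℝ → ℝ) {a : ℝ} (ha : 0 ≤ a) :
    TMfunc p θ σ u =
      wIntOn θ (fun r => phiP p (σ * |u r| ^ (p / (p - 1)))) (Set.Ioc 0 a) +
        wIntOn θ (fun r => phiP p (σ * |u r| ^ (p / (p - 1)))) (Set.Ioi a) := by
  rw [TMfunc, wInt, wIntOn, wIntOn, ← mul_add, ← lintegral_union measurableSet_Ioi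
    (Set.disjoint_left.2 fun x hx hx' => not_lt.2 hx.2 hx'), Set.Ioc_union_Ioi_eq_Ioi ha]

theorem stmt_3 (p α θ : ℝ) (hp : 2 ≤ p) (hα : α = p - 1) (hθ : 0 ≤ θ) :
    ∀ σ : ℝ, 0 ≤ σ → σ ≤ muC α θ → TMC p α θ σ < ⊤ := by
  subst hα
  intro σ hσ hσμ
  have hp0 : 0 < p := by linarith
  have hp1 : 0 < p - 1 := by linarith
  have hθ1 : 0 < θ + 1 := by linarith
  have hμ := muC_pos hp1.le hθ
  obtain ⟨C, hC, hmoser⟩ := exists_lintegral_exp_le hp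
  set h : ℝ := muC (p - 1) θ * omegaW θ ^ (-(1 / (p - 1))) with hh
  set T : ℝ :=
    σ * ((1 / omegaW θ) ^ (1 / p) + (1 / omegaW (p - 1)) ^ (1 / p)) ^ (p / (p - 1)) + 1 with hT
  set R : ℝ := 2 * Real.exp (h / (θ + 1)) with hR
  refine lt_of_le_of_lt (b := ENNReal.ofReal (omegaW θ) *
      (ENNReal.ofReal (R ^ (θ + 1) / (θ + 1)) * C) +
        ENNReal.ofReal ((σ / T) ^ (p - 1) * Real.exp T)) ?_ ?_
  · refine iSup₂_le fun u u' => iSup₂_le fun H hX => ?_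
    have hN := (Xnorm_le_one_iff hp0).1 hX
    obtain ⟨r₀, hr₀, hle⟩ := H.exists_abs_rpow_le hp hθ
      (ne_top_of_le_ne_top ENNReal.one_ne_top (le_self_add.trans hN)) le_rfl
    have hr₀0 : 0 < r₀ := one_pos.trans_le hr₀.1
    set r₁ : ℝ := r₀ * Real.exp (h / (θ + 1)) with hr₁
    have hr₁0 : 0 < r₁ := by positivity
    have hr₁R : r₁ ≤ R := mul_le_mul_of_nonneg_right (by linarith [hr₀.2]) (Real.exp_pos _).le
    have hstart : logVar θ r₁ h = r₀ := by
      rw [logVar, hr₁, mul_assoc, ← Real.exp_add, neg_div, add_neg_cancel, Real.exp_zero, mul_one]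
    have hE := H.energyControlled hp hθ hN hr₁0 hh (by rw [hstart]; exact hle)
    have hmeas : Measurable fun τ => muC (p - 1) θ ^ ((p - 1) / p) * |u (logVar θ r₁ τ)| :=
      ((H.continuousOn.comp_continuous continuous_logVar
        (logVar_pos hr₁0)).abs.const_mul _).measurable
    have hM := hmoser _ _ _ hmeas hE
    rw [TMfunc_eq_add p θ σ u hr₀0.le]
    refine add_le_add ?_ (H.wIntOn_phiP_Ioi_le hp hθ hN hσ hr₀.1 hT)
    refine mul_le_mul_right ?_ _
    calc _ ≤ ∫⁻ r in Set.Ioc 0 r₀,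
          ENNReal.ofReal (Real.exp (muC (p - 1) θ * |u r| ^ (p / (p - 1)))) *
            ENNReal.ofReal (r ^ θ) := by
          refine lintegral_mono fun r => mul_le_mul_left (ENNReal.ofReal_le_ofReal ?_) _
          refine (phiP_le_exp p (by positivity)).trans (Real.exp_le_exp.2 ?_)
          exact mul_le_mul_of_nonneg_right hσμ (by positivity)
      _ ≤ ENNReal.ofReal (r₁ ^ (θ + 1) / (θ + 1)) * ∫⁻ τ in Set.Ici h, ENNReal.ofReal
          (Real.exp (muC (p - 1) θ * |u (logVar θ r₁ τ)| ^ (p / (p - 1)) - τ)) := by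
          rw [← hstart]
          exact lintegral_Ioc_logVar_le hθ hr₁0 h fun r => muC (p - 1) θ * |u r| ^ (p / (p - 1))
      _ ≤ _ := by
          refine mul_le_mul' (ENNReal.ofReal_le_ofReal (div_le_div_of_nonneg_right
            (Real.rpow_le_rpow hr₁0.le hr₁R hθ1.le) hθ1.le)) (le_trans (le_of_eq ?_) hM)
          refine lintegral_congr fun τ => ?_
          rw [Real.mul_rpow (by positivity) (abs_nonneg _), ← Real.rpow_mul hμ.le,
            div_mul_div_comm, mul_comm p, div_self (by positivity), Real.rpow_one]
  · exact ENNReal.add_lt_top.2 ⟨ENNReal.mul_lt_top ENNReal.ofReal_lt_top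
      (ENNReal.mul_lt_top ENNReal.ofReal_lt_top hC), ENNReal.ofReal_lt_top⟩
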